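/- Let n ≥ 2 and let p_1,…,p_n, q_1,…,q_n, r_1,…,r_n be natural numbers. Then the abelianization of the group G_E(p,q,r) is isomorphic to ℤ × (ℤⁿ / (the ℤ-submodule spanned by the rows of M)), where M is the 2n×n integer matrix obtained by stacking the diagonal matrix A with A_{ii} = 2^{r_i} on top of the matrix B with B_{ii} = 2^{p_i}, B_{i,i+1} = −2^{q_i} for 1 ≤ i ≤ n−1, B_{n,1} = −2^{q_n}, and all other entries 0. -/

import Mathlib

/-- The relators of the echinus group `G_E(p,q,r) = ⟨b_1,…,b_n, t | b_j^{2^{r_j}} = 1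
(1 ≤ j ≤ n), b_i^{2^{p_i}} = b_{i+1}^{2^{q_i}} (1 ≤ i ≤ n−1),
t⁻¹ b_n^{2^{p_n}} t = b_1^{2^{q_n}}⟩`, where `some i` is `b_{i+1}` and `none` is `t`. -/
def echinusRels (n : ℕ) (hn : 0 < n) (p q r : Fin n → ℕ) :
    Set (FreeGroup (Option (Fin n))) :=
  {x | ∃ j : Fin n, x = FreeGroup.of (some j) ^ 2 ^ r j} ∪
  {x | ∃ i j : Fin n, (i : ℕ) + 1 = (j : ℕ) ∧
      x = FreeGroup.of (some i) ^ 2 ^ p i * (FreeGroup.of (some j) ^ 2 ^ q i)⁻¹} ∪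
  {(FreeGroup.of none)⁻¹ *
      FreeGroup.of (some ⟨n - 1, Nat.sub_lt hn Nat.one_pos⟩) ^
        2 ^ p ⟨n - 1, Nat.sub_lt hn Nat.one_pos⟩ *
      FreeGroup.of none *
      (FreeGroup.of (some ⟨0, hn⟩) ^ 2 ^ q ⟨n - 1, Nat.sub_lt hn Nat.one_pos⟩)⁻¹}

/-- The matrix `B` with `B_{ii} = 2^{p_i}`, `B_{i,i+1} = −2^{q_i}` for `1 ≤ i ≤ n−1`,
`B_{n,1} = −2^{q_n}`, and all other entries `0` (indices shifted down by one). -/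
def echinusB (n : ℕ) (p q : Fin n → ℕ) : Matrix (Fin n) (Fin n) ℤ :=
  Matrix.of fun i j =>
    if i = j then (2 : ℤ) ^ p i
    else if (i : ℕ) + 1 = (j : ℕ) then -(2 : ℤ) ^ q i
    else if (i : ℕ) = n - 1 ∧ (j : ℕ) = 0 then -(2 : ℤ) ^ q i
    else 0

/-- Each row of `echinusB` has two entries: `2 ^ p i` on the diagonal and `-2 ^ q i` at the cyclic
successor `j` of `i`. -/
theorem echinusB_row {n : ℕ} (p q : Fin n → ℕ) {i j : Fin n} (hij : i ≠ j)
    (h : (i : ℕ) + 1 = j ∨ ((i : ℕ) = n - 1 ∧ (j : ℕ) = 0)) :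
    echinusB n p q i = (2 : ℤ) ^ p i • Pi.single i 1 - (2 : ℤ) ^ q i • Pi.single j 1 := by
  have hij' : (i : ℕ) ≠ j := fun e => hij (Fin.ext e)
  ext k
  simp only [echinusB, Matrix.of_apply, Pi.sub_apply, Pi.smul_apply, Pi.single_apply, smul_eq_mul,
    Fin.ext_iff]
  split_ifs <;> omega

/-- Every index of `Fin n` has a cyclic successor, distinct from it when `2 ≤ n`. -/
theorem exists_cyclic_succ {n : ℕ} (hn2 : 2 ≤ n) (i : Fin n) :
    ∃ j : Fin n, i ≠ j ∧ ((i : ℕ) + 1 = j ∨ ((i : ℕ) = n - 1 ∧ (j : ℕ) = 0)) := by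
  by_cases h : (i : ℕ) + 1 < n
  · exact ⟨⟨i + 1, h⟩, by simp [Fin.ext_iff], Or.inl rfl⟩
  · exact ⟨⟨0, by omega⟩, by simp only [ne_eq, Fin.ext_iff]; omega, Or.inr ⟨by omega, rfl⟩⟩

/-- The `ℤ`-submodule spanned by the rows of the relation matrix. -/
abbrev echinusSpan (n : ℕ) (p q r : Fin n → ℕ) : Submodule ℤ (Fin n → ℤ) :=
  Submodule.span ℤ (Set.range fun i =>
    Matrix.fromRows (Matrix.diagonal fun i => (2 : ℤ) ^ r i) (echinusB n p q) i)

section Quotient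

variable {n : ℕ} (p q r : Fin n → ℕ)

theorem smul_mkQ_single_eq_zero (j : Fin n) :
    2 ^ r j • (echinusSpan n p q r).mkQ (Pi.single j 1) = 0 := by
  rw [← map_nsmul, Submodule.mkQ_apply, Submodule.Quotient.mk_eq_zero]
  refine Submodule.subset_span ⟨Sum.inl j, ?_⟩
  ext k
  simp [Matrix.diagonal_apply, Pi.single_apply, eq_comm]

theorem smul_mkQ_single_eq {i j : Fin n} (hij : i ≠ j)
    (h : (i : ℕ) + 1 = j ∨ ((i : ℕ) = n - 1 ∧ (j : ℕ) = 0)) :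
    2 ^ p i • (echinusSpan n p q r).mkQ (Pi.single i 1) =
      2 ^ q i • (echinusSpan n p q r).mkQ (Pi.single j 1) := by
  rw [← map_nsmul, ← map_nsmul, ← sub_eq_zero, ← map_sub, Submodule.mkQ_apply,
    Submodule.Quotient.mk_eq_zero]
  refine Submodule.subset_span ⟨Sum.inr i, ?_⟩
  change echinusB n p q i = _
  rw [echinusB_row p q hij h]
  ext k
  simp

/-- The images of the generators: `t` goes to the free summand, `b_i` to the `i`-th basis class. -/
def echinusGen : Option (Fin n) → Multiplicative (ℤ × ((Fin n → ℤ) ⧸ echinusSpan n p q r))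
  | none => Multiplicative.ofAdd (1, 0)
  | some i => Multiplicative.ofAdd (0, (echinusSpan n p q r).mkQ (Pi.single i 1))

theorem lift_echinusGen_eq_one (hn : 0 < n) (hn2 : 2 ≤ n) :
    ∀ x ∈ echinusRels n hn p q r, FreeGroup.lift (echinusGen p q r) x = 1 := by
  have key : ∀ i j : Fin n, i ≠ j → ((i : ℕ) + 1 = j ∨ ((i : ℕ) = n - 1 ∧ (j : ℕ) = 0)) →
      echinusGen p q r (some i) ^ 2 ^ p i = echinusGen p q r (some j) ^ 2 ^ q i := by
    intro i j hij h
    apply Multiplicative.toAdd.injective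
    simp only [echinusGen, toAdd_pow, toAdd_ofAdd, Prod.smul_mk, smul_zero]
    rw [smul_mkQ_single_eq p q r hij h]
  rintro x ((⟨j, rfl⟩ | ⟨i, j, hij, rfl⟩) | rfl)
  · rw [map_pow, FreeGroup.lift_apply_of]
    apply Multiplicative.toAdd.injective
    simp only [echinusGen, toAdd_pow, toAdd_ofAdd, Prod.smul_mk, smul_zero]
    rw [smul_mkQ_single_eq_zero]
    rfl
  · simp only [map_mul, map_inv, map_pow, FreeGroup.lift_apply_of]
    rw [key i j (by rintro rfl; omega) (Or.inl hij), mul_inv_cancel]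
  · simp only [map_mul, map_inv, map_pow, FreeGroup.lift_apply_of]
    rw [key _ ⟨0, hn⟩ (by simp only [ne_eq, Fin.ext_iff]; omega) (Or.inr ⟨rfl, rfl⟩),
      mul_right_comm _ _ (echinusGen p q r none), inv_mul_cancel, one_mul, mul_inv_cancel]

/-- The homomorphism from the abelianized echinus group given by `echinusGen`. -/
def echinusHom (hn : 0 < n) (hn2 : 2 ≤ n) :
    Abelianization (PresentedGroup (echinusRels n hn p q r)) →*
      Multiplicative (ℤ × ((Fin n → ℤ) ⧸ echinusSpan n p q r)) :=
  Abelianization.lift (PresentedGroup.toGroup (lift_echinusGen_eq_one p q r hn hn2))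

/-- The class of a generator in the abelianized echinus group, written additively. -/
def echinusClass (hn : 0 < n) (x : Option (Fin n)) :
    Additive (Abelianization (PresentedGroup (echinusRels n hn p q r))) :=
  Additive.ofMul (Abelianization.of (PresentedGroup.of x))

theorem smul_echinusClass_eq_zero (hn : 0 < n) (j : Fin n) :
    2 ^ r j • echinusClass p q r hn (some j) = 0 := by
  have h : PresentedGroup.mk (echinusRels n hn p q r) _ = 1 :=
    PresentedGroup.one_of_mem (Or.inl (Or.inl ⟨j, rfl⟩))
  simpa [echinusClass, PresentedGroup.of] using congrArg (fun y => Additive.ofMul (Abelianization.of y)) h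

theorem smul_echinusClass_eq (hn : 0 < n) {i j : Fin n}
    (h : (i : ℕ) + 1 = j ∨ ((i : ℕ) = n - 1 ∧ (j : ℕ) = 0)) :
    2 ^ p i • echinusClass p q r hn (some i) = 2 ^ q i • echinusClass p q r hn (some j) := by
  rw [← sub_eq_zero, sub_eq_add_neg]
  rcases h with h | ⟨hi, hj⟩
  · have h : PresentedGroup.mk (echinusRels n hn p q r) _ = 1 :=
      PresentedGroup.one_of_mem (Or.inl (Or.inr ⟨i, j, h, rfl⟩))
    simpa [echinusClass, PresentedGroup.of] using congrArg (fun y => Additive.ofMul (Abelianization.of y)) h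
  · obtain rfl : i = ⟨n - 1, Nat.sub_lt hn Nat.one_pos⟩ := Fin.ext hi
    obtain rfl : j = ⟨0, hn⟩ := Fin.ext hj
    have h : PresentedGroup.mk (echinusRels n hn p q r) _ = 1 :=
      PresentedGroup.one_of_mem (Or.inr rfl)
    have h' := congrArg (fun y => Additive.ofMul (Abelianization.of y)) h
    simp only [map_mul, map_inv, map_pow, ofMul_mul, ofMul_inv, ofMul_pow, map_one,
      ofMul_one] at h'
    rw [add_right_comm (-_), neg_add_cancel, zero_add] at h'
    exact h'

/-- The linear map out of `ℤⁿ` sending the `i`-th basis vector to the class of `b_i`. -/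
def echinusLin (hn : 0 < n) :
    (Fin n → ℤ) →ₗ[ℤ] Additive (Abelianization (PresentedGroup (echinusRels n hn p q r))) :=
  Fintype.linearCombination ℤ fun i => echinusClass p q r hn (some i)

theorem echinusLin_single (hn : 0 < n) (i : Fin n) :
    echinusLin p q r hn (Pi.single i 1) = echinusClass p q r hn (some i) := by
  simp [echinusLin, Fintype.linearCombination_apply_single]

theorem echinusSpan_le_ker (hn : 0 < n) (hn2 : 2 ≤ n) :
    echinusSpan n p q r ≤ LinearMap.ker (echinusLin p q r hn) := by
  rw [Submodule.span_le]
  rintro _ ⟨i | i, rfl⟩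
  · have : Matrix.fromRows (Matrix.diagonal fun i => (2 : ℤ) ^ r i) (echinusB n p q) (Sum.inl i) =
        2 ^ r i • Pi.single i 1 := by
      ext k
      simp [Matrix.diagonal_apply, Pi.single_apply, eq_comm]
    simp only [SetLike.mem_coe, LinearMap.mem_ker]
    rw [this, map_nsmul, echinusLin_single, smul_echinusClass_eq_zero]
  · obtain ⟨j, hij, h⟩ := exists_cyclic_succ hn2 i
    have : Matrix.fromRows (Matrix.diagonal fun i => (2 : ℤ) ^ r i) (echinusB n p q) (Sum.inr i) =
        2 ^ p i • Pi.single i 1 - 2 ^ q i • Pi.single j 1 := by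
      change echinusB n p q i = _
      rw [echinusB_row p q hij h]
      ext k
      simp
    simp only [SetLike.mem_coe, LinearMap.mem_ker]
    rw [this, map_sub, map_nsmul, map_nsmul, echinusLin_single, echinusLin_single,
      smul_echinusClass_eq p q r hn h, sub_self]

/-- The inverse of `echinusHom`, written additively. -/
def echinusInv (hn : 0 < n) (hn2 : 2 ≤ n) :
    (ℤ × ((Fin n → ℤ) ⧸ echinusSpan n p q r)) →ₗ[ℤ]
      Additive (Abelianization (PresentedGroup (echinusRels n hn p q r))) :=
  (LinearMap.toSpanSingleton ℤ _ (echinusClass p q r hn none)).coprod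
    ((echinusSpan n p q r).liftQ (echinusLin p q r hn) (echinusSpan_le_ker p q r hn hn2))

theorem echinusInv_echinusGen (hn : 0 < n) (hn2 : 2 ≤ n) (x : Option (Fin n)) :
    echinusInv p q r hn hn2 (echinusGen p q r x).toAdd = echinusClass p q r hn x := by
  cases x with
  | none => simp [echinusInv, echinusGen]
  | some i =>
    simp only [echinusInv, echinusGen, toAdd_ofAdd, LinearMap.coprod_apply, map_zero, zero_add,
      Submodule.mkQ_apply, Submodule.liftQ_apply, echinusLin_single]

theorem echinusHom_echinusClass (hn : 0 < n) (hn2 : 2 ≤ n) (x : Option (Fin n)) :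
    echinusHom p q r hn hn2 (echinusClass p q r hn x).toMul = echinusGen p q r x := by
  simp [echinusHom, echinusClass]

end Quotient

theorem stmt8 (n : ℕ) (hn : 0 < n) (hn2 : 2 ≤ n) (p q r : Fin n → ℕ) :
    Nonempty (Abelianization (PresentedGroup (echinusRels n hn p q r)) ≃*
      Multiplicative (ℤ × ((Fin n → ℤ) ⧸ Submodule.span ℤ (Set.range fun i =>
        Matrix.fromRows (Matrix.diagonal fun i => (2 : ℤ) ^ r i) (echinusB n p q) i)))) := by
  refine ⟨MonoidHom.toMulEquiv (echinusHom p q r hn hn2)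
    (AddMonoidHom.toMultiplicativeLeft (echinusInv p q r hn hn2).toAddMonoidHom) ?_ ?_⟩
  · ext x
    have h := echinusInv_echinusGen p q r hn hn2 x
    rw [← echinusHom_echinusClass p q r hn hn2 x] at h
    exact congrArg Additive.toMul h
  · have h : (MonoidHom.toAdditiveLeft (echinusHom p q r hn hn2)).toIntLinearMap.comp
        (echinusInv p q r hn hn2) = LinearMap.id := by
      have key : ∀ x, MonoidHom.toAdditiveLeft (echinusHom p q r hn hn2)
          (echinusInv p q r hn hn2 (echinusGen p q r x).toAdd) = (echinusGen p q r x).toAdd := by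
        intro x
        rw [echinusInv_echinusGen]
        exact congrArg Multiplicative.toAdd (echinusHom_echinusClass p q r hn hn2 x)
      refine LinearMap.prod_ext (LinearMap.ext_ring (key none)) ?_
      refine Submodule.linearMap_qext _ (LinearMap.pi_ext' fun i => LinearMap.ext_ring ?_)
      exact key (some i)
    exact MonoidHom.ext fun x => congrArg Multiplicative.ofAdd (LinearMap.congr_fun h x.toAdd)
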